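/- Let (a_n)_{n≥1} and (b_n)_{n≥1} be sequences of positive integers such that a_n ≤ r α^{n^l} and s₁ β₁^{n^{k₁}} ≤ b_n ≤ s₂ β₂^{n^{k₂}} for all n ≥ 1, where l is a non-negative real number, r, s₁, s₂, α, β₂, k₁, k₂ are positive real numbers, β₁ > 1, and k₁ + 1 > k₂ ≥ k₁. If l < k₁, then the generalized continued fraction K_{n=1}^∞ a_n/b_n converges to an irrational number τ with μ_I(τ) = 2. -/

import Mathlib

open Filter Real

/-- The asymptotic irrationality exponent: the infimum (in `EReal`, so that the
infimum of the empty set is `∞`) of all real `μ` for which there exist `c > 0`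
and `N₀ > 0` with `|τ - M/N| ≥ c / N ^ μ` for all integers `M, N` with `N ≥ N₀`. -/
noncomputable def muI (τ : ℝ) : EReal :=
  sInf ((fun μ : ℝ => (μ : EReal)) ''
    {μ : ℝ | ∃ c > (0:ℝ), ∃ N₀ > (0:ℝ), ∀ M N : ℤ,
      (N : ℝ) ≥ N₀ → |τ - (M : ℝ) / (N : ℝ)| ≥ c / (N : ℝ) ^ μ})

/-- Numerators of the convergents of the generalized continued fraction
`K_{n=1}^∞ a n / b n`. -/
def cfA (a b : ℕ → ℤ) : ℕ → ℤ
  | 0 => 0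
  | 1 => a 1
  | (n + 2) => b (n + 2) * cfA a b (n + 1) + a (n + 2) * cfA a b n

/-- Denominators of the convergents of the generalized continued fraction
`K_{n=1}^∞ a n / b n`. -/
def cfB (a b : ℕ → ℤ) : ℕ → ℤ
  | 0 => 1
  | 1 => b 1
  | (n + 2) => b (n + 2) * cfB a b (n + 1) + a (n + 2) * cfB a b n

theorem cfB_pos {a b : ℕ → ℤ} (ha : ∀ n, 1 ≤ n → 0 < a n) (hb : ∀ n, 1 ≤ n → 0 < b n) :
    ∀ n, 0 < cfB a b n
  | 0 => by simp [cfB]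
  | 1 => hb 1 le_rfl
  | n + 2 => by
    have h₁ := cfB_pos ha hb n
    have h₂ := cfB_pos ha hb (n + 1)
    have h₃ := ha (n + 2) (by omega)
    have h₄ := hb (n + 2) (by omega)
    rw [cfB]
    positivity

theorem mul_cfB_le_cfB_succ {a b : ℕ → ℤ} (ha : ∀ n, 1 ≤ n → 0 < a n)
    (hb : ∀ n, 1 ≤ n → 0 < b n) (n : ℕ) : b (n + 1) * cfB a b n ≤ cfB a b (n + 1) := by
  cases n with
  | zero => simp [cfB]
  | succ n =>
    rw [cfB]
    have := mul_pos (ha (n + 2) (by omega)) (cfB_pos ha hb n)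
    linarith

theorem cfB_le_cfB_succ {a b : ℕ → ℤ} (ha : ∀ n, 1 ≤ n → 0 < a n)
    (hb : ∀ n, 1 ≤ n → 0 < b n) (n : ℕ) : cfB a b n ≤ cfB a b (n + 1) := by
  have h₁ := mul_cfB_le_cfB_succ ha hb n
  have h₂ := cfB_pos ha hb n
  have h₃ := hb (n + 1) (by omega)
  nlinarith

theorem cfB_succ_le {a b : ℕ → ℤ} (ha : ∀ n, 1 ≤ n → 0 < a n)
    (hb : ∀ n, 1 ≤ n → 0 < b n) (n : ℕ) :
    cfB a b (n + 1) ≤ (b (n + 1) + a (n + 1)) * cfB a b n := by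
  cases n with
  | zero => simpa [cfB] using (ha 1 le_rfl).le
  | succ n =>
    rw [cfB]
    have := mul_le_mul_of_nonneg_left (cfB_le_cfB_succ ha hb n) (ha (n + 2) (by omega)).le
    linarith

/-- The determinant formula for consecutive convergents. -/
theorem cfA_mul_cfB_sub (a b : ℕ → ℤ) (n : ℕ) :
    cfA a b (n + 1) * cfB a b n - cfA a b n * cfB a b (n + 1) =
      (-1) ^ n * ∏ i ∈ Finset.range (n + 1), a (i + 1) := by
  induction n with
  | zero => simp [cfA, cfB]
  | succ n ih =>
    rw [Finset.prod_range_succ, cfA, cfB, pow_succ]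
    linear_combination (-a (n + 2)) * ih

theorem eventually_mul_rpow_le {p q : ℝ} (hpq : p < q) (C : ℝ) {D : ℝ} (hD : 0 < D) :
    ∀ᶠ n : ℕ in atTop, C * (n : ℝ) ^ p ≤ D * (n : ℝ) ^ q := by
  have h : Tendsto (fun n : ℕ => D * (n : ℝ) ^ (q - p)) atTop atTop :=
    ((tendsto_rpow_atTop (sub_pos.2 hpq)).comp tendsto_natCast_atTop_atTop).const_mul_atTop hD
  filter_upwards [h.eventually_ge_atTop C, eventually_gt_atTop 0] with n hn hn₀
  have hn₁ : (0 : ℝ) < n := by exact_mod_cast hn₀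
  refine (mul_le_mul_of_nonneg_right hn (by positivity)).trans_eq ?_
  rw [mul_assoc, ← Real.rpow_add hn₁, sub_add_cancel]

theorem rpow_div_le_sum_rpow {k : ℝ} (hk : 0 ≤ k) (n : ℕ) :
    (n : ℝ) ^ (k + 1) / (k + 1) ≤ ∑ i ∈ Finset.range n, ((i + 1 : ℕ) : ℝ) ^ k := by
  have hk₁ : 0 < k + 1 := by linarith
  induction n with
  | zero => simp [Real.zero_rpow hk₁.ne']
  | succ n ih =>
    rw [Finset.sum_range_succ]
    refine le_trans ?_ (add_le_add_left ih _)
    have hn : (0 : ℝ) < n + 1 := by positivity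
    have hs : (-1 : ℝ) ≤ -(1 / (n + 1)) := by
      rw [neg_le_neg_iff, div_le_one hn]
      linarith [(Nat.cast_nonneg n : (0 : ℝ) ≤ n)]
    have hB := one_add_mul_self_le_rpow_one_add hs (by linarith : 1 ≤ k + 1)
    have he : 1 + -(1 / ((n : ℝ) + 1)) = n / (n + 1) := by field_simp; ring
    rw [he, Real.div_rpow (by positivity) hn.le, le_div_iff₀ (by positivity)] at hB
    push_cast
    have hp : ((n : ℝ) + 1) ^ (k + 1) = (n + 1) ^ k * (n + 1) := Real.rpow_add_one hn.ne' k
    rw [div_le_iff₀ hk₁, add_mul, div_mul_cancel₀ _ hk₁.ne']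
    have : (1 + (k + 1) * -(1 / ((n : ℝ) + 1))) * (n + 1) ^ (k + 1) =
        (n + 1) ^ (k + 1) - (n + 1) ^ k * (k + 1) := by
      rw [hp]; field_simp; ring
    linarith

/-- A sequence of fractions whose consecutive determinants decay geometrically relative to the
denominators converges, with the expected error. -/
theorem exists_tendsto_div_of_det {A B P : ℕ → ℝ} (hB : ∀ n, 0 < B n) (hB₁ : ∀ n, 1 ≤ B n)
    (hP : ∀ n, 0 < P n) (hdet : ∀ n, |A (n + 1) * B n - A n * B (n + 1)| = P (n + 1))
    (hhalf : ∀ᶠ n in atTop, 2 * P (n + 2) * B n ≤ P (n + 1) * B (n + 2))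
    (hlim : Tendsto (fun n => P n / B n) atTop (nhds 0)) :
    ∃ τ, Tendsto (fun n => A n / B n) atTop (nhds τ) ∧
      ∀ᶠ n in atTop, |B n * τ - A n| ≤ 2 * (P (n + 1) / B (n + 1)) := by
  obtain ⟨n₀, hn₀⟩ := eventually_atTop.1 hhalf
  set d : ℕ → ℝ := fun n => P (n + 1) / (B n * B (n + 1)) with hd
  have hd₀ : ∀ n, 0 < d n := fun n => div_pos (hP _) (mul_pos (hB _) (hB _))
  have hstep : ∀ n, |A (n + 1) / B (n + 1) - A n / B n| = d n := fun n => by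
    have h₁ := hB n
    have h₂ := hB (n + 1)
    rw [div_sub_div _ _ h₂.ne' h₁.ne', abs_div, abs_of_pos (mul_pos h₂ h₁),
      mul_comm (B (n + 1)) (A n), mul_comm (B (n + 1)) (B n), hdet n]
  have hdhalf : ∀ n, n₀ ≤ n → 2 * d (n + 1) ≤ d n := fun n hn => by
    have h₁ := hB n
    have h₂ := hB (n + 1)
    have h₃ := hB (n + 2)
    have h := hn₀ n hn
    simp only [hd]
    rw [mul_div_assoc', div_le_div_iff₀ (mul_pos h₂ h₃) (mul_pos h₁ h₂)]
    nlinarith [mul_le_mul_of_nonneg_right h h₂.le]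
  have htail : ∀ n, n₀ ≤ n → ∀ m, n ≤ m →
      |A m / B m - A n / B n| ≤ 2 * d n - 2 * d m := fun n hn m hm => by
    induction m, hm using Nat.le_induction with
    | base => simp
    | succ m hm ih =>
      have h₁ := hstep m
      have h₂ := hdhalf m (hn.trans hm)
      have h₃ := abs_sub_le (A (m + 1) / B (m + 1)) (A m / B m) (A n / B n)
      linarith
  have hdlim : Tendsto (fun n => 2 * d n) atTop (nhds 0) := by
    have h := ((tendsto_add_atTop_iff_nat 1).2 hlim).const_mul 2
    rw [mul_zero] at h
    refine squeeze_zero (fun n => by have := hd₀ n; positivity) (fun n => ?_) h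
    simp only [hd]
    gcongr
    · exact (hP _).le
    · exact hB _
    · exact le_mul_of_one_le_left (hB _).le (hB₁ n)
  have hcauchy : CauchySeq (fun n => A n / B n) := by
    rw [Metric.cauchySeq_iff']
    intro ε hε
    obtain ⟨n, hn, hn'⟩ := ((hdlim.eventually_lt_const hε).and (eventually_ge_atTop n₀)).exists
    refine ⟨n, fun m hm => ?_⟩
    rw [Real.dist_eq]
    have h₁ := htail n hn' m hm
    have h₂ := hd₀ m
    linarith
  obtain ⟨τ, hτ⟩ := cauchySeq_tendsto_of_complete hcauchy
  refine ⟨τ, hτ, ?_⟩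
  filter_upwards [eventually_ge_atTop n₀] with n hn
  have h₁ : |τ - A n / B n| ≤ 2 * d n := by
    refine le_of_tendsto ((hτ.sub_const _).abs) ?_
    filter_upwards [eventually_ge_atTop n] with m hm
    have h₁ := htail n hn m hm
    have h₂ := hd₀ m
    linarith
  have h₂ : B n * τ - A n = B n * (τ - A n / B n) := by
    have := (hB n).ne'
    field_simp
  rw [h₂, abs_mul, abs_of_pos (hB n)]
  refine (mul_le_mul_of_nonneg_left h₁ (hB n).le).trans_eq ?_
  have := (hB n).ne'
  have := (hB (n + 1)).ne'
  simp only [hd]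
  field_simp

/-- Integer approximations `A n / B n` of `τ` whose denominators grow subpolynomially fast and
whose determinants are subpolynomial in the denominators bound every rational approximation. -/
theorem exists_le_abs_sub_of_approximations {τ : ℝ} {A B P : ℕ → ℤ} (hB : ∀ n, 0 < B n)
    (hBmono : ∀ n, B n ≤ B (n + 1)) (hP : ∀ n, 0 < P n)
    (hdet : ∀ n, A (n + 1) * B n - A n * B (n + 1) ≠ 0)
    (herr : ∀ᶠ n in atTop, |(B n : ℝ) * τ - A n| ≤ 2 * ((P (n + 1) : ℝ) / B (n + 1)))
    (hanti : ∀ᶠ n in atTop, (P (n + 1) : ℝ) / B (n + 1) ≤ (P n : ℝ) / B n)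
    (hlim : Tendsto (fun n => (P n : ℝ) / B n) atTop (nhds 0))
    (hPB : ∀ δ > (0 : ℝ), ∀ᶠ n in atTop, Real.log (P n) ≤ δ * Real.log (B n))
    (hBB : ∀ δ > (0 : ℝ), ∀ᶠ n in atTop, Real.log (B (n + 1)) ≤ (1 + δ) * Real.log (B n))
    {ε : ℝ} (hε : 0 < ε) :
    ∃ c > (0 : ℝ), ∃ N₀ > (0 : ℝ), ∀ M N : ℤ, (N : ℝ) ≥ N₀ →
      |τ - (M : ℝ) / (N : ℝ)| ≥ c / (N : ℝ) ^ (2 + ε) := by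
  have hδ : 0 < ε / (2 + ε) := by positivity
  obtain ⟨n₀, hn₀⟩ := eventually_atTop.1
    (((herr.and hanti).and (hPB _ hδ)).and (hBB _ hδ))
  have hBR : ∀ n, (0 : ℝ) < B n := fun n => by exact_mod_cast hB n
  have hPR : ∀ n, (0 : ℝ) < P n := fun n => by exact_mod_cast hP n
  have hQ : ∀ n, (0 : ℝ) < (P n : ℝ) / B n := fun n => div_pos (hPR n) (hBR n)
  refine ⟨1 / (2 * 4 ^ (1 + ε)), by positivity, 1 / ((P (n₀ + 1) : ℝ) / B (n₀ + 1)),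
    one_div_pos.2 (hQ _), fun M N hN => ?_⟩
  have hNpos : (0 : ℝ) < N := (one_div_pos.2 (hQ _)).trans_le hN
  have hex : ∃ n, n₀ ≤ n ∧ 4 * (N : ℝ) * ((P (n + 1) : ℝ) / B (n + 1)) ≤ 1 := by
    have h := ((tendsto_add_atTop_iff_nat 1).2 hlim).const_mul (4 * (N : ℝ))
    rw [mul_zero] at h
    obtain ⟨n, h₁, h₂⟩ := ((h.eventually_lt_const one_pos).and (eventually_ge_atTop n₀)).exists
    exact ⟨n, h₂, h₁.le⟩
  classical
  obtain ⟨n, ⟨hn, hnN⟩, hmin⟩ : ∃ n, (n₀ ≤ n ∧ 4 * (N : ℝ) * ((P (n + 1) : ℝ) / B (n + 1)) ≤ 1) ∧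
      ∀ m < n, ¬ (n₀ ≤ m ∧ 4 * (N : ℝ) * ((P (m + 1) : ℝ) / B (m + 1)) ≤ 1) :=
    ⟨Nat.find hex, Nat.find_spec hex, fun m hm => Nat.find_min hex hm⟩
  have hn_gt : n₀ < n := by
    refine lt_of_le_of_ne hn fun h => ?_
    subst h
    rw [ge_iff_le, div_le_iff₀ (hQ _)] at hN
    linarith
  have hprev : 1 < 4 * (N : ℝ) * ((P n : ℝ) / B n) := by
    obtain ⟨m, rfl⟩ : ∃ m, n = m + 1 := ⟨n - 1, by omega⟩
    have := hmin m (by omega)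
    by_contra! h
    exact this ⟨by omega, h⟩
  obtain ⟨⟨⟨herr₀, -⟩, hPn⟩, hBn⟩ := hn₀ n hn
  obtain ⟨⟨⟨herr₁, -⟩, -⟩, -⟩ := hn₀ (n + 1) (by omega)
  have hanti₁ := (hn₀ (n + 1) (by omega)).1.1.2
  have hbound : (B (n + 1) : ℝ) ≤ (4 * N) ^ (1 + ε) := by
    rw [mul_div_assoc', lt_div_iff₀ (hBR n), one_mul] at hprev
    have h₁ := Real.log_le_log (hBR n) hprev.le
    rw [Real.log_mul (by positivity) (hPR n).ne'] at h₁
    rw [← Real.log_le_log_iff (hBR _) (by positivity), Real.log_rpow (by positivity)]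
    have h₂ : (1 - ε / (2 + ε)) * Real.log (B n) ≤ Real.log (4 * N) := by linarith
    refine hBn.trans ?_
    have h₃ : 1 + ε / (2 + ε) = (1 + ε) * (1 - ε / (2 + ε)) := by field_simp; ring
    rw [h₃, mul_assoc]
    exact mul_le_mul_of_nonneg_left h₂ (by linarith)
  have key : ∀ m, B m ≤ B (n + 1) → |(B m : ℝ) * τ - A m| * N ≤ 1 / 2 → M * B m - N * A m ≠ 0 →
      1 / (2 * N * (B (n + 1) : ℝ)) ≤ |τ - (M : ℝ) / N| := fun m hm hem hne => by
    have h₁ : (1 : ℝ) ≤ |(M : ℝ) * B m - N * A m| := by exact_mod_cast Int.one_le_abs hne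
    have h₂ : (M : ℝ) * B m - N * A m = (B m * τ - A m) * N - B m * N * (τ - M / N) := by
      field_simp; ring
    have h₃ := abs_sub ((B m * τ - A m) * N) (B m * N * (τ - M / N))
    rw [← h₂, abs_mul, abs_of_pos hNpos, abs_mul, abs_of_pos (mul_pos (hBR m) hNpos)] at h₃
    have h₄ : (B m : ℝ) ≤ B (n + 1) := by exact_mod_cast hm
    have h₅ : (B m : ℝ) * N * |τ - M / N| ≤ B (n + 1) * N * |τ - M / N| := by gcongr
    have := hBR (n + 1)
    rw [div_le_iff₀ (by positivity)]
    linarith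
  have hmain : 1 / (2 * N * (B (n + 1) : ℝ)) ≤ |τ - (M : ℝ) / N| := by
    by_cases h : M * B n - N * A n = 0
    · refine key (n + 1) le_rfl ?_ fun h' => ?_
      · refine (mul_le_mul_of_nonneg_right (herr₁.trans
          (mul_le_mul_of_nonneg_left hanti₁ zero_le_two)) hNpos.le).trans ?_
        linarith
      · have hN' : N ≠ 0 := by rintro rfl; simp at hNpos
        refine hdet n ((mul_eq_zero.1 ?_).resolve_left hN')
        linear_combination B (n + 1) * h - B n * h'
    · refine key n (hBmono n) ?_ h
      refine (mul_le_mul_of_nonneg_right herr₀ hNpos.le).trans ?_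
      linarith
  refine ge_iff_le.2 (le_trans ?_ hmain)
  rw [div_div]
  have := hBR (n + 1)
  refine one_div_le_one_div_of_le (by positivity) ?_
  have h : (2 : ℝ) * 4 ^ (1 + ε) * N ^ (2 + ε) = 2 * N * (4 * N) ^ (1 + ε) := by
    rw [Real.mul_rpow (by norm_num) hNpos.le, show 2 + ε = (1 + ε) + 1 by ring,
      Real.rpow_add_one hNpos.ne']
    ring
  rw [h]
  gcongr

theorem irrational_of_le_abs_sub {τ μ c N₀ : ℝ} (hc : 0 < c) (hN₀ : 0 < N₀)
    (h : ∀ M N : ℤ, (N : ℝ) ≥ N₀ → |τ - (M : ℝ) / (N : ℝ)| ≥ c / (N : ℝ) ^ μ) :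
    Irrational τ := by
  rintro ⟨q, rfl⟩
  obtain ⟨k, hk⟩ := exists_nat_ge N₀
  have hk₀ : (0 : ℝ) < k := hN₀.trans_le hk
  have hden : (1 : ℝ) ≤ q.den := by exact_mod_cast q.pos
  have hN : (((k * q.den : ℤ)) : ℝ) ≥ N₀ := by
    push_cast
    nlinarith
  have h₁ := h (k * q.num) (k * q.den) hN
  have h₂ : (q : ℝ) = ((k * q.num : ℤ) : ℝ) / ((k * q.den : ℤ) : ℝ) := by
    push_cast
    rw [mul_div_mul_left _ _ hk₀.ne']
    exact_mod_cast (Rat.num_div_den q).symm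
  rw [← h₂, sub_self, abs_zero] at h₁
  have : 0 < c / (((k * q.den : ℤ)) : ℝ) ^ μ := div_pos hc (Real.rpow_pos_of_pos (hN₀.trans_le hN) _)
  linarith

theorem two_le_muI {τ : ℝ} (hτ : Irrational τ) : ((2 : ℝ) : EReal) ≤ muI τ := by
  refine le_sInf ?_
  rintro _ ⟨μ, ⟨c, hc, N₀, hN₀, h⟩, rfl⟩
  rw [EReal.coe_le_coe_iff]
  by_contra! hμ
  have hinf := Real.infinite_rat_abs_sub_lt_one_div_den_sq_of_irrational hτ
  have hlarge : ∀ᶠ x : ℝ in atTop, 1 < c * x ^ (2 - μ) :=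
    ((tendsto_rpow_atTop (by linarith : 0 < 2 - μ)).const_mul_atTop hc).eventually_gt_atTop 1
  obtain ⟨X, hX⟩ := eventually_atTop.1 (hlarge.and (eventually_ge_atTop N₀))
  obtain ⟨K, hK⟩ := exists_nat_ge X
  obtain ⟨q, hq, hqK⟩ : ∃ q : ℚ, |τ - q| < 1 / (q.den : ℝ) ^ 2 ∧ K ≤ q.den := by
    by_contra! hcon
    refine hinf (Set.Finite.subset (s := ⋃ d ∈ Set.Iio K,
      {q : ℚ | |τ - q| < 1 / (q.den : ℝ) ^ 2 ∧ q.den = d}) ?_ fun q hq => ?_)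
    · refine (Set.finite_Iio K).biUnion fun d _ => ?_
      refine Set.Finite.of_finite_image (f := Rat.num) ?_ ?_
      · refine (Set.finite_Icc (-⌈(|τ| + 1) * d⌉) ⌈(|τ| + 1) * d⌉).subset ?_
        rintro _ ⟨q, ⟨hq, rfl⟩, rfl⟩
        have hden : (1 : ℝ) ≤ q.den := by exact_mod_cast q.pos
        have h₁ : |(q : ℝ)| ≤ |τ| + 1 := by
          have h₂ : 1 / (q.den : ℝ) ^ 2 ≤ 1 := by
            rw [div_le_one (by positivity)]
            nlinarith
          have h₃ := abs_sub_abs_le_abs_sub (q : ℝ) τ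
          rw [abs_sub_comm] at h₃
          linarith
        have h₂ : |(q.num : ℝ)| ≤ (|τ| + 1) * q.den := by
          have h₃ : (q : ℝ) * q.den = q.num := by exact_mod_cast Rat.mul_den_eq_num q
          rw [← h₃, abs_mul, abs_of_pos (by linarith : (0 : ℝ) < q.den)]
          gcongr
        have h₃ := h₂.trans (Int.le_ceil _)
        rw [abs_le] at h₃
        exact ⟨by exact_mod_cast h₃.1, by exact_mod_cast h₃.2⟩
      · rintro x ⟨-, hx⟩ y ⟨-, hy⟩ hxy
        exact Rat.ext hxy (hx.trans hy.symm)
    · simp only [Set.mem_iUnion, Set.mem_Iio]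
      exact ⟨q.den, hcon q hq, hq, rfl⟩
  have hXq : X ≤ q.den := hK.trans (by exact_mod_cast hqK)
  obtain ⟨h₁, h₂⟩ := hX _ hXq
  have hpos : (0 : ℝ) < q.den := by exact_mod_cast q.pos
  have h₃ := h q.num q.den (by exact_mod_cast h₂)
  rw [Int.cast_natCast, show (q.num : ℝ) / q.den = q by exact_mod_cast Rat.num_div_den q] at h₃
  have h₄ : c / (q.den : ℝ) ^ μ = c * (q.den : ℝ) ^ (2 - μ) * (1 / (q.den : ℝ) ^ 2) := by
    rw [Real.rpow_sub hpos, Real.rpow_two]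
    field_simp
  rw [h₄] at h₃
  have h₅ : (0 : ℝ) < 1 / (q.den : ℝ) ^ 2 := by positivity
  nlinarith

theorem muI_le_two {τ : ℝ} (h : ∀ ε > (0 : ℝ), ∃ c > (0 : ℝ), ∃ N₀ > (0 : ℝ), ∀ M N : ℤ,
    (N : ℝ) ≥ N₀ → |τ - (M : ℝ) / (N : ℝ)| ≥ c / (N : ℝ) ^ (2 + ε)) :
    muI τ ≤ ((2 : ℝ) : EReal) := by
  refine EReal.le_of_forall_lt_iff_le.1 fun z hz => ?_
  rw [EReal.coe_lt_coe_iff] at hz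
  refine sInf_le ⟨z, ?_, rfl⟩
  have := h (z - 2) (by linarith)
  rwa [add_sub_cancel] at this

theorem log_prod_le {a : ℕ → ℤ} (ha0 : ∀ n, 1 ≤ n → 0 < a n) {l r α : ℝ} (hl : 0 ≤ l)
    (hr : 0 < r) (hα : 0 < α) (ha : ∀ n : ℕ, 1 ≤ n → (a n : ℝ) ≤ r * α ^ ((n : ℝ) ^ l)) (n : ℕ) :
    Real.log ((∏ i ∈ Finset.range n, a (i + 1) : ℤ) : ℝ) ≤
      (|Real.log r| + |Real.log α|) * (n : ℝ) ^ (l + 1) := by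
  have hpos : ∀ i, (0 : ℝ) < a (i + 1) := fun i => by exact_mod_cast ha0 (i + 1) (by omega)
  rw [Int.cast_prod, Real.log_prod fun i _ => (hpos i).ne']
  have hterm : ∀ i ∈ Finset.range n,
      Real.log (a (i + 1)) ≤ (|Real.log r| + |Real.log α|) * (n : ℝ) ^ l := fun i hi => by
    have h₁ := Real.log_le_log (hpos i) (ha (i + 1) (by omega))
    rw [Real.log_mul hr.ne' (by positivity), Real.log_rpow hα] at h₁
    have hi' : i + 1 ≤ n := Finset.mem_range.1 hi
    have hin : ((i + 1 : ℕ) : ℝ) ≤ n := by exact_mod_cast hi'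
    have h₂ : ((i + 1 : ℕ) : ℝ) ^ l ≤ (n : ℝ) ^ l := by gcongr
    have h₃ : (1 : ℝ) ≤ (n : ℝ) ^ l :=
      Real.one_le_rpow (by exact_mod_cast (by omega : 1 ≤ n)) hl
    have h₄ : ((i + 1 : ℕ) : ℝ) ^ l * Real.log α ≤ (n : ℝ) ^ l * |Real.log α| := by
      refine (mul_le_mul_of_nonneg_left (le_abs_self _) (by positivity)).trans ?_
      gcongr
    nlinarith [le_abs_self (Real.log r), abs_nonneg (Real.log r)]
  refine (Finset.sum_le_card_nsmul _ _ _ hterm).trans_eq ?_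
  rw [Finset.card_range, nsmul_eq_mul, Real.rpow_add_one' (Nat.cast_nonneg n) (by linarith)]
  ring

theorem le_log_cfB {a b : ℕ → ℤ} (ha0 : ∀ n, 1 ≤ n → 0 < a n) (hb0 : ∀ n, 1 ≤ n → 0 < b n)
    {s β k : ℝ} (hs : 0 < s) (hβ : 1 < β) (hk : 0 ≤ k)
    (hb : ∀ n : ℕ, 1 ≤ n → s * β ^ ((n : ℝ) ^ k) ≤ (b n : ℝ)) (n : ℕ) :
    n * Real.log s + Real.log β * ((n : ℝ) ^ (k + 1) / (k + 1)) ≤ Real.log (cfB a b n) := by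
  have hsum : n * Real.log s + Real.log β * ∑ i ∈ Finset.range n, ((i + 1 : ℕ) : ℝ) ^ k ≤
      Real.log (cfB a b n) := by
    induction n with
    | zero => simp [cfB]
    | succ n ih =>
      have hB : (0 : ℝ) < cfB a b n := by exact_mod_cast cfB_pos ha0 hb0 n
      have hbn : (0 : ℝ) < b (n + 1) := by exact_mod_cast hb0 (n + 1) (by omega)
      have hβ₀ : 0 < β := by linarith
      have h₁ : (b (n + 1) : ℝ) * cfB a b n ≤ cfB a b (n + 1) := by
        exact_mod_cast mul_cfB_le_cfB_succ ha0 hb0 n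
      have h₂ := Real.log_le_log (mul_pos hbn hB) h₁
      rw [Real.log_mul hbn.ne' hB.ne'] at h₂
      have h₃ := Real.log_le_log (by positivity) (hb (n + 1) (by omega))
      rw [Real.log_mul hs.ne' (by positivity), Real.log_rpow hβ₀] at h₃
      rw [Finset.sum_range_succ]
      push_cast at h₃ ih ⊢
      linarith
  exact (add_le_add_right (mul_le_mul_of_nonneg_left (rpow_div_le_sum_rpow hk n)
    (Real.log_pos hβ).le) _).trans hsum

/-- exponential growth, case `l < k₁`.  If `a_n ≤ r α^{n^l}` and
`s₁ β₁^{n^{k₁}} ≤ b_n ≤ s₂ β₂^{n^{k₂}}` with `β₁ > 1`, `k₁ + 1 > k₂ ≥ k₁` and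
`l < k₁`, then the continued fraction converges to an irrational `τ` with
`μ_I(τ) = 2`. -/
theorem gcf_muI_eq_two_of_exponential_growth
    (a b : ℕ → ℤ) (ha0 : ∀ n, 1 ≤ n → 0 < a n) (hb0 : ∀ n, 1 ≤ n → 0 < b n)
    (l r s₁ s₂ α β₁ β₂ k₁ k₂ : ℝ)
    (hl : 0 ≤ l) (hr : 0 < r) (hs₁ : 0 < s₁) (hs₂ : 0 < s₂)
    (hα : 0 < α) (hβ₁ : 1 < β₁) (hβ₂ : 0 < β₂)
    (hk₁ : 0 < k₁) (hk₂ : 0 < k₂) (hk : k₁ + 1 > k₂) (hkk : k₂ ≥ k₁)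
    (hlk : l < k₁)
    (ha : ∀ n : ℕ, 1 ≤ n → (a n : ℝ) ≤ r * α ^ ((n : ℝ) ^ l))
    (hb : ∀ n : ℕ, 1 ≤ n →
      s₁ * β₁ ^ ((n : ℝ) ^ k₁) ≤ (b n : ℝ) ∧ (b n : ℝ) ≤ s₂ * β₂ ^ ((n : ℝ) ^ k₂)) :
    ∃ τ : ℝ,
      Tendsto (fun n => (cfA a b n : ℝ) / (cfB a b n : ℝ)) atTop (nhds τ) ∧
      Irrational τ ∧
      muI τ = ((2 : ℝ) : EReal) := by
  have hα_log : ∀ n : ℕ, 1 ≤ n → Real.log (a n) ≤ Real.log r + (n : ℝ) ^ l * Real.log α :=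
    fun n hn => by
      have h₀ : (0 : ℝ) < a n := by exact_mod_cast ha0 n hn
      have h := Real.log_le_log h₀ (ha n hn)
      rwa [Real.log_mul hr.ne' (by positivity), Real.log_rpow hα] at h
  have hβ₁pos : 0 < β₁ := by linarith
  have hlogβ₁ : 0 < Real.log β₁ := Real.log_pos hβ₁
  have hBpos : ∀ n, (0 : ℝ) < cfB a b n := fun n => by exact_mod_cast cfB_pos ha0 hb0 n
  have hB₁ : ∀ n, (1 : ℝ) ≤ cfB a b n := fun n => by exact_mod_cast cfB_pos ha0 hb0 n
  set P : ℕ → ℤ := fun n => ∏ i ∈ Finset.range n, a (i + 1) with hPdef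
  have hP : ∀ n, 0 < P n := fun n => Finset.prod_pos fun i _ => ha0 (i + 1) (by omega)
  have hPR : ∀ n, (0 : ℝ) < P n := fun n => by exact_mod_cast hP n
  have hPsucc : ∀ n, P (n + 1) = P n * a (n + 1) := fun n => Finset.prod_range_succ _ _
  have hdet : ∀ n, |cfA a b (n + 1) * cfB a b n - cfA a b n * cfB a b (n + 1)| = P (n + 1) :=
    fun n => by
      rw [cfA_mul_cfB_sub, abs_mul, abs_pow, abs_neg, abs_one, one_pow, one_mul]
      exact abs_of_pos (hP (n + 1))
  have hab : ∀ᶠ n in atTop, a n ≤ b n := by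
    filter_upwards [eventually_mul_rpow_le hlk (|Real.log r| + |Real.log α| + |Real.log s₁|) hlogβ₁,
      eventually_ge_atTop 1] with n hn hn1
    have h₀ : (0 : ℝ) < a n := by exact_mod_cast ha0 n hn1
    have h₁ : (0 : ℝ) < b n := by exact_mod_cast hb0 n hn1
    have h₂ := hα_log n hn1
    have h₃ := Real.log_le_log (by positivity) (hb n hn1).1
    rw [Real.log_mul hs₁.ne' (by positivity), Real.log_rpow hβ₁pos] at h₃
    have h₄ : (1 : ℝ) ≤ (n : ℝ) ^ l := Real.one_le_rpow (by exact_mod_cast hn1) hl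
    have h₅ := (Real.log_le_log_iff h₀ h₁).1 (by
      nlinarith [le_abs_self (Real.log r), abs_nonneg (Real.log r), le_abs_self (Real.log α),
        neg_abs_le (Real.log s₁), abs_nonneg (Real.log s₁)])
    exact_mod_cast h₅
  have hab' : ∀ᶠ n in atTop, a (n + 1) ≤ b (n + 1) := (tendsto_add_atTop_nat 1).eventually hab
  set c : ℝ := Real.log β₁ / (2 * (k₁ + 1)) with hc
  have hcpos : 0 < c := by positivity
  have hBlog : ∀ᶠ n : ℕ in atTop, c * (n : ℝ) ^ (k₁ + 1) ≤ Real.log (cfB a b n) := by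
    filter_upwards [eventually_mul_rpow_le (by linarith : (1 : ℝ) < k₁ + 1) (-Real.log s₁) hcpos]
      with n hn
    have h := le_log_cfB ha0 hb0 hs₁ hβ₁ hk₁.le (fun n hn => (hb n hn).1) n
    rw [Real.rpow_one] at hn
    have h₁ : Real.log β₁ * ((n : ℝ) ^ (k₁ + 1) / (k₁ + 1)) = 2 * (c * (n : ℝ) ^ (k₁ + 1)) := by
      rw [hc]; field_simp
    linarith
  have hPB : ∀ δ > (0 : ℝ), ∀ᶠ n in atTop,
      Real.log (P n) ≤ δ * Real.log (cfB a b n) := fun δ hδ => by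
    filter_upwards [hBlog, eventually_mul_rpow_le (by linarith : l + 1 < k₁ + 1)
      (|Real.log r| + |Real.log α|) (mul_pos hδ hcpos)] with n h₁ h₂
    have h₃ := log_prod_le ha0 hl hr hα ha n
    have h₄ := mul_le_mul_of_nonneg_left h₁ hδ.le
    linarith
  have hBB : ∀ δ > (0 : ℝ), ∀ᶠ n in atTop,
      Real.log (cfB a b (n + 1)) ≤ (1 + δ) * Real.log (cfB a b n) := fun δ hδ => by
    filter_upwards [hBlog, hab', eventually_ge_atTop 1,
      eventually_mul_rpow_le (by linarith : k₂ < k₁ + 1)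
      ((Real.log 2 + |Real.log s₂| + |Real.log β₂|) * 2 ^ k₂) (mul_pos hδ hcpos)]
      with n h₁ h₂ hn h₃
    have hn' : (1 : ℝ) ≤ n := by exact_mod_cast hn
    have hbpos : (0 : ℝ) < b (n + 1) := by exact_mod_cast hb0 (n + 1) (by omega)
    have h₄ : (cfB a b (n + 1) : ℝ) ≤ 2 * b (n + 1) * cfB a b n := by
      have h : (cfB a b (n + 1) : ℝ) ≤ (b (n + 1) + a (n + 1)) * cfB a b n := by
        exact_mod_cast cfB_succ_le ha0 hb0 n
      have h' : (a (n + 1) : ℝ) ≤ b (n + 1) := by exact_mod_cast h₂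
      nlinarith [hBpos n]
    have h₅ := Real.log_le_log (hBpos _) h₄
    rw [Real.log_mul (by positivity) (hBpos n).ne', Real.log_mul two_ne_zero hbpos.ne'] at h₅
    have h₆ := Real.log_le_log hbpos (hb (n + 1) (by omega)).2
    rw [Real.log_mul hs₂.ne' (by positivity), Real.log_rpow hβ₂] at h₆
    have h₇ : ((n + 1 : ℕ) : ℝ) ^ k₂ ≤ 2 ^ k₂ * (n : ℝ) ^ k₂ := by
      rw [← Real.mul_rpow zero_le_two (by linarith)]
      push_cast
      gcongr
      linarith
    have h₈ : (1 : ℝ) ≤ ((n + 1 : ℕ) : ℝ) ^ k₂ :=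
      Real.one_le_rpow (by push_cast; linarith) hk₂.le
    have h₉ : Real.log 2 + Real.log s₂ + ((n + 1 : ℕ) : ℝ) ^ k₂ * Real.log β₂ ≤
        (Real.log 2 + |Real.log s₂| + |Real.log β₂|) * ((n + 1 : ℕ) : ℝ) ^ k₂ := by
      have hl2 : 0 < Real.log 2 := Real.log_pos one_lt_two
      nlinarith [le_abs_self (Real.log s₂), abs_nonneg (Real.log s₂), le_abs_self (Real.log β₂)]
    have hC : 0 ≤ Real.log 2 + |Real.log s₂| + |Real.log β₂| := by
      have hl2 : 0 < Real.log 2 := Real.log_pos one_lt_two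
      positivity
    have h₁₀ := mul_le_mul_of_nonneg_left h₇ hC
    have h₁₁ := mul_le_mul_of_nonneg_left h₁ hδ.le
    linarith
  have hBtop : Tendsto (fun n => Real.log (cfB a b n)) atTop atTop :=
    tendsto_atTop_mono' _ hBlog (((tendsto_rpow_atTop (by linarith : 0 < k₁ + 1)).comp
      tendsto_natCast_atTop_atTop).const_mul_atTop hcpos)
  have hlim : Tendsto (fun n => (P n : ℝ) / cfB a b n) atTop (nhds 0) := by
    have h₁ : Tendsto (fun n => Real.exp (-(1 / 2 * Real.log (cfB a b n)))) atTop (nhds 0) :=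
      Real.tendsto_exp_neg_atTop_nhds_zero.comp (hBtop.const_mul_atTop (by norm_num))
    refine squeeze_zero' (Eventually.of_forall fun n => (div_pos (hPR n) (hBpos n)).le) ?_ h₁
    filter_upwards [hPB (1 / 2) (by norm_num)] with n hn
    rw [← Real.log_le_iff_le_exp (div_pos (hPR n) (hBpos n)),
      Real.log_div (hPR n).ne' (hBpos n).ne']
    linarith
  have hanti : ∀ᶠ n in atTop, (P (n + 1) : ℝ) / cfB a b (n + 1) ≤ (P n : ℝ) / cfB a b n := by
    filter_upwards [hab'] with n hn
    rw [div_le_div_iff₀ (hBpos _) (hBpos _), hPsucc]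
    have h₁ := mul_le_mul_of_nonneg_right hn (cfB_pos ha0 hb0 n).le
    have h₂ := mul_le_mul_of_nonneg_left (h₁.trans (mul_cfB_le_cfB_succ ha0 hb0 n)) (hP n).le
    rw [← mul_assoc] at h₂
    exact_mod_cast h₂
  have hhalf : ∀ᶠ n in atTop,
      2 * (P (n + 2) : ℝ) * cfB a b n ≤ P (n + 1) * cfB a b (n + 2) := by
    filter_upwards [(tendsto_add_atTop_nat 2).eventually hab] with n hn
    have h₁ : a (n + 2) * cfB a b n ≤ b (n + 2) * cfB a b (n + 1) :=
      mul_le_mul hn (cfB_le_cfB_succ ha0 hb0 n) (cfB_pos ha0 hb0 n).le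
        (hb0 (n + 2) (by omega)).le
    have h₂ : 2 * P (n + 2) * cfB a b n ≤ P (n + 1) * cfB a b (n + 2) := by
      rw [hPsucc (n + 1), cfB]
      nlinarith [mul_le_mul_of_nonneg_left h₁ (hP (n + 1)).le]
    exact_mod_cast h₂
  obtain ⟨τ, hτ, herr⟩ := exists_tendsto_div_of_det (A := fun n => (cfA a b n : ℝ)) hBpos hB₁ hPR
    (fun n => by exact_mod_cast hdet n) hhalf hlim
  have hbound := fun ε (hε : (0 : ℝ) < ε) =>
    exists_le_abs_sub_of_approximations (cfB_pos ha0 hb0) (cfB_le_cfB_succ ha0 hb0) hP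
      (fun n => abs_pos.1 ((hP (n + 1)).trans_eq (hdet n).symm)) herr hanti hlim hPB hBB hε
  obtain ⟨c', hc', N₀, hN₀, h⟩ := hbound 1 one_pos
  have hirr := irrational_of_le_abs_sub hc' hN₀ h
  exact ⟨τ, hτ, hirr, le_antisymm (muI_le_two hbound) (two_le_muI hirr)⟩
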